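/- Let Φ ∈ ℝ^{m×N}, let S ⊆ {1,…,N} with |S| ≤ s, let x ∈ ℝ^N, e′ ∈ ℝ^m, and set y = Φx_S + e′. Let T ⊆ {1,…,N} with |T| = t, and let z_p be a least-squares solution over support T for data y. Suppose Φ satisfies the RIP of order s+t with constant δ₁ < 1 and the RIP of order t with constant δ₂. Then ‖(x_S − z_p)_T‖₂ ≤ δ₁·‖x_S − z_p‖₂ + √(1+δ₂)·‖e′‖₂. -/

import Mathlib

open Matrix Finset

/-- The Euclidean norm of a vector in `ℝⁿ`. -/
noncomputable def norm2 {n : ℕ} (v : Fin n → ℝ) : ℝ := Real.sqrt (∑ i, (v i) ^ 2)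

/-- The support of a vector: the set of indices of its nonzero entries. -/
noncomputable def supp {n : ℕ} (v : Fin n → ℝ) : Finset (Fin n) :=
  Finset.univ.filter (fun i => v i ≠ 0)

/-- `restrict v T` keeps the entries of `v` with indices in `T` and sets all others to zero. -/
def restrict {n : ℕ} (v : Fin n → ℝ) (T : Finset (Fin n)) : Fin n → ℝ :=
  fun i => if i ∈ T then v i else 0

/-- `Φ` satisfies the restricted isometry property of order `t` with constant `δ`. -/
def RIP (m N : ℕ) (Φ : Matrix (Fin m) (Fin N) ℝ) (t : ℕ) (δ : ℝ) : Prop :=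
  ∀ v : Fin N → ℝ, (supp v).card ≤ t →
    (1 - δ) * (norm2 v) ^ 2 ≤ (norm2 (Φ.mulVec v)) ^ 2 ∧
    (norm2 (Φ.mulVec v)) ^ 2 ≤ (1 + δ) * (norm2 v) ^ 2

/-- `z` is a least-squares solution over support `T` for data `y`. -/
def IsLeastSquares {m N : ℕ} (Φ : Matrix (Fin m) (Fin N) ℝ) (y : Fin m → ℝ)
    (T : Finset (Fin N)) (z : Fin N → ℝ) : Prop :=
  supp z ⊆ T ∧ ∀ w : Fin N → ℝ, supp w ⊆ T →
    norm2 (y - Φ.mulVec z) ≤ norm2 (y - Φ.mulVec w)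

/-- `U` is a set of indices of the `k` largest magnitude entries of `v`. -/
def IsLargest {n : ℕ} (v : Fin n → ℝ) (k : ℕ) (U : Finset (Fin n)) : Prop :=
  U.card = k ∧ ∀ i ∈ U, ∀ j ∉ U, |v j| ≤ |v i|

theorem norm2_sq {n : ℕ} (v : Fin n → ℝ) : norm2 v ^ 2 = v ⬝ᵥ v := by
  unfold norm2
  rw [Real.sq_sqrt (Finset.sum_nonneg fun i _ => sq_nonneg _)]
  simp [dotProduct, sq]

theorem norm2_nonneg {n : ℕ} (v : Fin n → ℝ) : 0 ≤ norm2 v := Real.sqrt_nonneg _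

theorem dot_le {n : ℕ} (v w : Fin n → ℝ) : v ⬝ᵥ w ≤ norm2 v * norm2 w :=
  Real.sum_mul_le_sqrt_mul_sqrt _ _ _

theorem supp_sub_iff {n : ℕ} (v : Fin n → ℝ) (T : Finset (Fin n)) :
    supp v ⊆ T ↔ ∀ i, i ∉ T → v i = 0 := by
  simp only [supp, Finset.subset_iff, Finset.mem_filter, Finset.mem_univ, true_and]
  exact forall_congr' fun i => not_imp_comm

theorem ls_orth {m N : ℕ} (Φ : Matrix (Fin m) (Fin N) ℝ) (y : Fin m → ℝ)
    (T : Finset (Fin N)) (z : Fin N → ℝ) (h : IsLeastSquares Φ y T z)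
    (w : Fin N → ℝ) (hw : supp w ⊆ T) : (y - Φ.mulVec z) ⬝ᵥ Φ.mulVec w = 0 := by
  obtain ⟨hz, hmin⟩ := h
  rw [supp_sub_iff] at hz hw
  set r := y - Φ.mulVec z with hr
  set p := r ⬝ᵥ Φ.mulVec w with hp
  set q := Φ.mulVec w ⬝ᵥ Φ.mulVec w with hq
  have hq0 : 0 ≤ q := by rw [hq, ← norm2_sq]; positivity
  have key : ∀ c : ℝ, 0 ≤ -2 * c * p + c ^ 2 * q := by
    intro c
    have h1 := hmin (z + c • w) (by
      rw [supp_sub_iff]; intro i hi; simp [hz i hi, hw i hi])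
    have h2 := pow_le_pow_left₀ (norm2_nonneg _) h1 2
    have h3 : y - Φ.mulVec (z + c • w) = r - c • Φ.mulVec w := by
      rw [Matrix.mulVec_add, Matrix.mulVec_smul, hr]; abel
    rw [h3, norm2_sq, norm2_sq] at h2
    simp only [sub_dotProduct, dotProduct_sub, smul_dotProduct, dotProduct_smul, smul_eq_mul] at h2
    rw [dotProduct_comm (Φ.mulVec w) r, ← hp, ← hq] at h2
    linarith
  have h4 := key (p / (q + 1))
  have h5 : -2 * (p / (q + 1)) * p + (p / (q + 1)) ^ 2 * q = -(p ^ 2 * (q + 2)) / (q + 1) ^ 2 := by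
    field_simp; ring
  rw [h5] at h4
  by_contra hne
  have h6 : 0 < p ^ 2 * (q + 2) := by positivity
  have h7 : -(p ^ 2 * (q + 2)) / (q + 1) ^ 2 < 0 :=
    div_neg_of_neg_of_pos (by linarith) (by positivity)
  linarith

theorem rip_dot {m N : ℕ} (Φ : Matrix (Fin m) (Fin N) ℝ) (k : ℕ) (δ : ℝ) (h : RIP m N Φ k δ)
    (U : Finset (Fin N)) (hU : U.card ≤ k) (d u : Fin N → ℝ) (hd : supp d ⊆ U) (hu : supp u ⊆ U)
    (hd0 : 0 < norm2 d) (hu0 : 0 < norm2 u) :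
    d ⬝ᵥ u - Φ.mulVec d ⬝ᵥ Φ.mulVec u ≤ δ * norm2 d * norm2 u := by
  rw [supp_sub_iff] at hd hu
  set α := norm2 d with hα
  set β := norm2 u with hβ
  have h1 := (h (β • d + α • u) ((Finset.card_le_card ((supp_sub_iff _ U).2 (by
    intro i hi; simp [hd i hi, hu i hi]))).trans hU)).1
  have h2 := (h (β • d - α • u) ((Finset.card_le_card ((supp_sub_iff _ U).2 (by
    intro i hi; simp [hd i hi, hu i hi]))).trans hU)).2
  have hdd := norm2_sq d
  have huu := norm2_sq u
  rw [norm2_sq, norm2_sq] at h1 h2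
  simp only [Matrix.mulVec_add, Matrix.mulVec_sub, Matrix.mulVec_smul, sub_dotProduct,
    dotProduct_sub, add_dotProduct, dotProduct_add,
    smul_dotProduct, dotProduct_smul, smul_eq_mul] at h1 h2
  rw [dotProduct_comm (Φ.mulVec u) (Φ.mulVec d), dotProduct_comm u d, ← hdd, ← huu] at h1 h2
  rw [← hα, ← hβ] at h1 h2
  have hpos : 0 < α * β := mul_pos hd0 hu0
  refine le_of_mul_le_mul_left ?_ hpos
  linarith

theorem stmt_4 {m N : ℕ} (Φ : Matrix (Fin m) (Fin N) ℝ) (s t : ℕ)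
    (S : Finset (Fin N)) (hS : S.card ≤ s)
    (x : Fin N → ℝ) (e' : Fin m → ℝ) (y : Fin m → ℝ)
    (hy : y = Φ.mulVec (restrict x S) + e')
    (T : Finset (Fin N)) (hT : T.card = t)
    (zp : Fin N → ℝ) (hzp : IsLeastSquares Φ y T zp)
    (δ₁ δ₂ : ℝ) (hδ₁0 : 0 ≤ δ₁) (hδ₁1 : δ₁ < 1) (hδ₂0 : 0 ≤ δ₂) (hδ₂1 : δ₂ ≤ 1)
    (hRIP1 : RIP m N Φ (s + t) δ₁) (hRIP2 : RIP m N Φ t δ₂) :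
    norm2 (restrict (restrict x S - zp) T) ≤
      δ₁ * norm2 (restrict x S - zp) + Real.sqrt (1 + δ₂) * norm2 e' := by
  have ho := fun w hw => ls_orth Φ y T zp hzp w hw
  have hz := (supp_sub_iff _ _).1 hzp.1
  set d := restrict x S - zp with hd
  set u := restrict d T with hu
  have hr : y - Φ.mulVec zp = Φ.mulVec d + e' := by
    rw [hy, hd, Matrix.mulVec_sub]; abel
  have huT : supp u ⊆ T := by
    rw [supp_sub_iff]; intro i hi; simp [hu, _root_.restrict, hi]
  have huS : supp u ⊆ S ∪ T := huT.trans Finset.subset_union_right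
  have hdS : supp d ⊆ S ∪ T := by
    rw [supp_sub_iff]; intro i hi
    rw [Finset.mem_union, not_or] at hi
    simp [hd, _root_.restrict, hi.1, hz i hi.2]
  have hdu : d ⬝ᵥ u = norm2 u ^ 2 := by
    rw [norm2_sq]
    refine Finset.sum_congr rfl fun i _ => ?_
    by_cases hi : i ∈ T <;> simp [hu, _root_.restrict, hi]
  have hcs := dot_le d u
  have hd0 := norm2_nonneg d
  have he0 := norm2_nonneg e'
  rcases (norm2_nonneg u).eq_or_lt with h0 | hupos
  · rw [← h0]; positivity
  have hdpos : 0 < norm2 d := by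
    rcases hd0.eq_or_lt with h | h
    · rw [← h, hdu, zero_mul] at hcs
      have : 0 < norm2 u ^ 2 := by positivity
      linarith
    · exact h
  have hcard : (S ∪ T).card ≤ s + t := (Finset.card_union_le _ _).trans (by omega)
  have h1 := rip_dot Φ (s + t) δ₁ hRIP1 (S ∪ T) hcard d u hdS huS hdpos hupos
  have h2 := ho u huT
  rw [hr, add_dotProduct] at h2
  have h3 : norm2 (Φ.mulVec u) ≤ Real.sqrt (1 + δ₂) * norm2 u := by
    have h := (hRIP2 u ((Finset.card_le_card huT).trans hT.le)).2
    refine (pow_le_pow_iff_left₀ (norm2_nonneg _) (by positivity) two_ne_zero).1 ?_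
    rw [mul_pow, Real.sq_sqrt (by linarith)]
    exact h
  have h4 := dot_le e' (Φ.mulVec (-u))
  have h5 : norm2 (Φ.mulVec (-u)) = norm2 (Φ.mulVec u) := by
    simp [norm2, Matrix.mulVec_neg]
  rw [h5, Matrix.mulVec_neg, dotProduct_neg] at h4
  have h6 := mul_le_mul_of_nonneg_left h3 he0
  refine le_of_mul_le_mul_right ?_ hupos
  nlinarith
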